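/- Let G be a finite HCA graph with no twins and no universal vertices, and let A be an arc model of the bundle hypergraph B(G), i.e., an arc system such that there is a hypergraph isomorphism from B(G) to A. Then there exists a sharpening σ : A → A' of A such that the sharp arc system A' satisfies the Helly property. -/

import Mathlib

/-- A *maxclique* of a graph is an inclusion-maximal clique. -/
def SimpleGraph.IsMaxclique {V : Type*} (G : SimpleGraph V) (C : Set V) : Prop :=
  G.IsClique C ∧ ∀ D : Set V, G.IsClique D → C ⊆ D → D = C

/-- The *bundle* `B_v` of a vertex `v`: the set of all maxcliques containing `v`. -/
def SimpleGraph.bundle {V : Type*} (G : SimpleGraph V) (v : V) : Set (Set V) :=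
  {C | G.IsMaxclique C ∧ v ∈ C}

/-- The closed neighborhood `N[v]` of a vertex `v`. -/
def SimpleGraph.closedNbhd {V : Type*} (G : SimpleGraph V) (v : V) : Set V :=
  {u | u = v ∨ G.Adj u v}

/-- `α` is an intersection representation of `G`. -/
def IsIntersectionRep {V β : Type*} (G : SimpleGraph V) (α : V → Set β) : Prop :=
  ∀ u v : V, u ≠ v → (G.Adj u v ↔ (α u ∩ α v).Nonempty)

/-- A family of sets has the *Helly property*. -/
def HellyFamily {β : Type*} (F : Set (Set β)) : Prop :=
  ∀ S : Set (Set β), S ⊆ F → S.Nonempty →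
    (∀ A ∈ S, ∀ B ∈ S, (A ∩ B).Nonempty) → (⋂₀ S).Nonempty

/-- The arc `[a,b]` on the `n`-point circle. -/
def arcIcc (n : ℕ) (a b : ZMod n) : Set (ZMod n) := {x | (x - a).val ≤ (b - a).val}

/-- `A` is an arc on the `n`-point circle. -/
def IsArc (n : ℕ) (A : Set (ZMod n)) : Prop := ∃ a b : ZMod n, A = arcIcc n a b

/-- `G` is a Helly circular-arc graph. -/
def IsHCA {V : Type*} (G : SimpleGraph V) : Prop :=
  ∃ n : ℕ, 3 ≤ n ∧ ∃ α : V → Set (ZMod n),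
    IsIntersectionRep G α ∧ (∀ v : V, IsArc n (α v)) ∧ HellyFamily (Set.range α)

/-- The point set of an arc given with its designated extreme points `p = (p.1, p.2)`. -/
def arcPts {n : ℕ} (p : ZMod n × ZMod n) : Set (ZMod n) := arcIcc n p.1 p.2

/-- A system of arcs-with-extreme-points is *sharp*: it consists of `m` arcs on the
`2m`-point circle, and every point of the circle is the start point or the end point
of exactly one arc. -/
def SharpSys {m : ℕ} (P : Set (ZMod m × ZMod m)) : Prop :=
  2 * Nat.card P = m ∧ ∀ x : ZMod m, ∃! p, p ∈ P ∧ (p.1 = x ∨ p.2 = x)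

/-- Two sets *overlap*: they intersect but neither includes the other. -/
def SetsOverlap {β : Type*} (A B : Set β) : Prop :=
  (A ∩ B).Nonempty ∧ ¬A ⊆ B ∧ ¬B ⊆ A

/-- Two arcs *strictly overlap*: they overlap and do not cover the whole circle. -/
def StrictOv {n : ℕ} (A B : Set (ZMod n)) : Prop :=
  SetsOverlap A B ∧ A ∪ B ≠ Set.univ

/-- Arc `A` *overlaps `B` on the left* (`A ⪯* B`): they strictly overlap and the
end point of `A` lies in `B`. -/
def LeftOv {n : ℕ} (A B : Set (ZMod n)) : Prop :=
  StrictOv A B ∧ ∃ a b : ZMod n, A = arcIcc n a b ∧ A ≠ Set.univ ∧ b ∈ B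

/-- `⪯*` for arcs given with designated extreme points. -/
def pLeftOv {n : ℕ} (p q : ZMod n × ZMod n) : Prop :=
  StrictOv (arcPts p) (arcPts q) ∧ p.2 ∈ arcPts q

/-- Arcs with designated extreme points form a *circle cover* (`p ⋈ q`):
equivalently, their union is the whole circle and each contains both extreme
points of the other. -/
def CircleCover {n : ℕ} (p q : ZMod n × ZMod n) : Prop :=
  arcPts p ∪ arcPts q = Set.univ ∧
    q.1 ∈ arcPts p ∧ q.2 ∈ arcPts p ∧ p.1 ∈ arcPts q ∧ p.2 ∈ arcPts q

theorem ZMod.val_add_one_ite {n : ℕ} (hn : 2 ≤ n) (z : ZMod n) :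
    (z + 1).val = if z.val = n - 1 then 0 else z.val + 1 := by
  have : NeZero n := ⟨by omega⟩
  have : Fact (1 < n) := ⟨by omega⟩
  have hz := z.val_lt
  rw [ZMod.val_add, ZMod.val_one]
  split_ifs with h
  · rw [h, Nat.sub_add_cancel (by omega), Nat.mod_self]
  · exact Nat.mod_eq_of_lt (by omega)

theorem ZMod.val_neg_sub_one {n : ℕ} [NeZero n] (z : ZMod n) :
    (-z - 1).val + z.val = n - 1 := by
  have hz := z.val_lt
  have : -z - 1 = ((n - 1 - z.val : ℕ) : ZMod n) := by
    rw [Nat.cast_sub (by omega), Nat.cast_sub (by omega)]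
    simp
    ring
  rw [this, ZMod.val_natCast_of_lt (by omega)]
  omega

theorem mem_arcIcc_iff_val_sub {n : ℕ} [NeZero n] (a b x : ZMod n) :
    x ∈ arcIcc n a b ↔ (b - x).val ≤ (b - a).val := by
  have h : (b - a).val = ((b - x).val + (x - a).val) % n := by
    rw [← ZMod.val_add]; congr 1; ring
  have h1 := (b - x).val_lt
  have h2 := (x - a).val_lt
  change (x - a).val ≤ (b - a).val ↔ _
  rcases lt_or_ge ((b - x).val + (x - a).val) n with h3 | h3
  · rw [Nat.mod_eq_of_lt h3] at h
    omega
  · rw [Nat.mod_eq_sub_mod h3, Nat.mod_eq_of_lt (by omega)] at h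
    omega

theorem ncard_arcIcc {n : ℕ} [NeZero n] (a b : ZMod n) :
    (arcIcc n a b).ncard = (b - a).val + 1 := by
  have h : arcIcc n a b = (fun i : ℕ => a + (i : ZMod n)) ''
      (Finset.range ((b - a).val + 1) : Set ℕ) := by
    ext x
    simp only [Set.mem_image, Finset.coe_range, Set.mem_Iio]
    constructor
    · intro hx
      exact ⟨(x - a).val, Nat.lt_succ_of_le hx, by simp⟩
    · rintro ⟨i, hi, rfl⟩
      have := (b - a).val_lt
      change (a + (i : ZMod n) - a).val ≤ _
      rw [add_sub_cancel_left, ZMod.val_natCast_of_lt (by omega)]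
      omega
  rw [h, Set.InjOn.ncard_image, Set.ncard_coe_finset, Finset.card_range]
  intro i hi j hj hij
  have := (b - a).val_lt
  simp only [Finset.coe_range, Set.mem_Iio] at hi hj
  have := congrArg ZMod.val (add_left_cancel hij)
  rwa [ZMod.val_natCast_of_lt (by omega), ZMod.val_natCast_of_lt (by omega)] at this

theorem val_sub_add_one_lt_of_arcIcc_ne_univ {n : ℕ} [NeZero n] {a b : ZMod n}
    (h : arcIcc n a b ≠ Set.univ) : (b - a).val + 1 < n := by
  by_contra hc
  refine h (Set.eq_univ_of_forall fun x => ?_)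
  have := (x - a).val_lt
  change (x - a).val ≤ _
  omega

theorem eq_of_notMem_of_add_one_mem_arcIcc {n : ℕ} (hn : 2 ≤ n) {a b g : ZMod n}
    (h : g ∉ arcIcc n a b) (h' : g + 1 ∈ arcIcc n a b) : g + 1 = a := by
  have h1 : ¬ (g - a).val ≤ (b - a).val := h
  have h2 : (g + 1 - a).val ≤ (b - a).val := h'
  have h3 := ZMod.val_add_one_ite hn (g - a)
  rw [show g - a + 1 = g + 1 - a by ring] at h3
  have : (g + 1 - a).val = 0 := by split_ifs at h3 <;> omega
  exact sub_eq_zero.1 ((ZMod.val_eq_zero _).1 this)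

theorem eq_of_mem_of_add_one_notMem_arcIcc {n : ℕ} (hn : 2 ≤ n) {a b g : ZMod n}
    (h : g ∈ arcIcc n a b) (h' : g + 1 ∉ arcIcc n a b) : g = b := by
  have : NeZero n := ⟨by omega⟩
  have h1 : (g - a).val ≤ (b - a).val := h
  have h2 : ¬ (g + 1 - a).val ≤ (b - a).val := h'
  have h3 := ZMod.val_add_one_ite hn (g - a)
  rw [show g - a + 1 = g + 1 - a by ring] at h3
  have : (g - a).val = (b - a).val := by split_ifs at h3 <;> omega
  exact sub_left_injective (ZMod.val_injective n this)

theorem right_add_one_notMem_arcIcc {n : ℕ} (hn : 2 ≤ n) {a b : ZMod n}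
    (h : arcIcc n a b ≠ Set.univ) : b + 1 ∉ arcIcc n a b := by
  have : NeZero n := ⟨by omega⟩
  have h0 := val_sub_add_one_lt_of_arcIcc_ne_univ h
  intro h2
  have h2 : (b + 1 - a).val ≤ (b - a).val := h2
  have h3 := ZMod.val_add_one_ite hn (b - a)
  rw [show b - a + 1 = b + 1 - a by ring] at h3
  split_ifs at h3 <;> omega

theorem left_sub_one_notMem_arcIcc {n : ℕ} (hn : 2 ≤ n) {a b : ZMod n}
    (h : arcIcc n a b ≠ Set.univ) : a - 1 ∉ arcIcc n a b := by
  have : NeZero n := ⟨by omega⟩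
  have h0 := val_sub_add_one_lt_of_arcIcc_ne_univ h
  intro h2
  have h2 : (a - 1 - a).val ≤ (b - a).val := h2
  have h3 := ZMod.val_neg_sub_one (0 : ZMod n)
  rw [show a - 1 - a = -0 - 1 by ring] at h2
  rw [ZMod.val_zero] at h3
  omega

theorem left_mem_arcIcc {n : ℕ} (a b : ZMod n) : a ∈ arcIcc n a b := by
  simp [arcIcc]

theorem right_mem_arcIcc {n : ℕ} (a b : ZMod n) : b ∈ arcIcc n a b := by
  simp [arcIcc]

theorem arcIcc_union_eq_univ {n : ℕ} [NeZero n] {a g b : ZMod n}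
    (h : (arcIcc n a g ∩ arcIcc n (g + 1) b).Nonempty) :
    arcIcc n a g ∪ arcIcc n (g + 1) b = Set.univ := by
  obtain ⟨y, hy1, hy2⟩ := h
  refine Set.eq_univ_of_forall fun x => ?_
  rw [mem_arcIcc_iff_val_sub] at hy1
  change (y - (g + 1)).val ≤ _ at hy2
  rw [Set.mem_union, mem_arcIcc_iff_val_sub]
  change _ ∨ (x - (g + 1)).val ≤ _
  have h1 := ZMod.val_neg_sub_one (y - (g + 1))
  have h2 := ZMod.val_neg_sub_one (x - (g + 1))
  rw [show -(y - (g + 1)) - 1 = g - y by ring] at h1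
  rw [show -(x - (g + 1)) - 1 = g - x by ring] at h2
  omega

/-- The point with offset `k` in the gap between `g` and `g + 1`, once every gap of the
`n`-point circle has been subdivided into `2 * n` points. -/
def gapPoint (n : ℕ) (g : ZMod n) (k : ℕ) : ZMod (2 * n * n) :=
  ((2 * n * g.val + k : ℕ) : ZMod (2 * n * n))

theorem val_gapPoint_sub {n : ℕ} [NeZero n] (g h : ZMod n) {k s : ℕ} (hk : k < 2 * n)
    (hs : s < 2 * n) :
    (gapPoint n g k - gapPoint n h s).val =
      if (g - h).val = 0 ∧ k < s then 2 * n * n + k - s else 2 * n * (g - h).val + k - s := by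
  have hn : 0 < n := NeZero.pos n
  obtain ⟨c, hc⟩ : ∃ c, (g - h).val + h.val = g.val + n * c := by
    have : g.val = ((g - h).val + h.val) % n := by rw [← ZMod.val_add, sub_add_cancel]
    exact ⟨((g - h).val + h.val) / n, by rw [this]; exact (Nat.mod_add_div _ _).symm⟩
  have hd := (g - h).val_lt
  set d := (g - h).val with hdd
  have hdn : 2 * n * (d + 1) ≤ 2 * n * n := Nat.mul_le_mul_left _ hd
  have key : ∀ w : ℕ, w < 2 * n * n → (∃ e : ℕ, w + s = 2 * n * d + k + 2 * n * n * e) →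
      (gapPoint n g k - gapPoint n h s).val = w := by
    rintro w hw ⟨e, he⟩
    have : gapPoint n g k - gapPoint n h s = (w : ZMod (2 * n * n)) := by
      rw [sub_eq_iff_eq_add, gapPoint, gapPoint, ← Nat.cast_add]
      have : w + (2 * n * h.val + s) = 2 * n * g.val + k + 2 * n * n * (c + e) := by
        have : 2 * n * (d + h.val) = 2 * n * (g.val + n * c) := by rw [hc]
        linarith
      rw [this, Nat.cast_add (2 * n * g.val + k), Nat.cast_mul (2 * n * n), ZMod.natCast_self,
        zero_mul, add_zero]
    rw [this, ZMod.val_natCast_of_lt hw]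
  split_ifs with hcase
  · obtain ⟨h0, hlt⟩ := hcase
    rw [h0, zero_add, mul_one] at hdn
    have hnn : 2 * n * 1 ≤ 2 * n * n := Nat.mul_le_mul_left _ hn
    refine key _ (by omega) ⟨1, ?_⟩
    rw [h0, mul_zero]
    omega
  · have : s ≤ 2 * n * d + k := by
      rcases Nat.eq_zero_or_pos d with h0 | h0
      · omega
      · have := Nat.mul_le_mul_left (2 * n) h0
        simp only [Nat.succ_eq_add_one, zero_add, mul_one] at this
        omega
    exact key _ (by rw [mul_add] at hdn; omega) ⟨0, by omega⟩

theorem gapPoint_inj {n : ℕ} [NeZero n] {g h : ZMod n} {k s : ℕ} (hk : k < 2 * n)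
    (hs : s < 2 * n) (he : gapPoint n g k = gapPoint n h s) : g = h ∧ k = s := by
  have h1 := val_gapPoint_sub g h hk hs
  rw [he, sub_self, ZMod.val_zero] at h1
  have hn : 0 < n := NeZero.pos n
  have hnn : 2 * n * 1 ≤ 2 * n * n := Nat.mul_le_mul_left _ hn
  split_ifs at h1 with hc
  · omega
  · rcases Nat.eq_zero_or_pos (g - h).val with h0 | h0
    · rw [h0] at h1
      exact ⟨sub_eq_zero.1 ((ZMod.val_eq_zero _).1 h0), by omega⟩
    · have := Nat.mul_le_mul_left (2 * n) h0
      simp only [Nat.succ_eq_add_one, zero_add, mul_one] at this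
      omega

/-- Membership of the gap point `(g, k)` in the sharpened version of the arc `A`. -/
def InSharp {n : ℕ} (A : Set (ZMod n)) (g : ZMod n) (k : ℕ) : Prop :=
  (g ∈ A ∧ g + 1 ∈ A) ∨ (g ∉ A ∧ g + 1 ∈ A ∧ 2 * (n - A.ncard) + 1 ≤ k) ∨
    (g ∈ A ∧ g + 1 ∉ A ∧ k ≤ 2 * A.ncard)

theorem gapPoint_mem_arcIcc_iff {n : ℕ} (hn : 2 ≤ n) {a b : ZMod n}
    (h : arcIcc n a b ≠ Set.univ) (g : ZMod n) {k : ℕ} (hk : k < 2 * n) :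
    gapPoint n g k ∈ arcIcc (2 * n * n)
        (gapPoint n (a - 1) (2 * (n - (arcIcc n a b).ncard) + 1))
        (gapPoint n b (2 * (arcIcc n a b).ncard)) ↔
      InSharp (arcIcc n a b) g k := by
  have : NeZero n := ⟨by omega⟩
  have hl := val_sub_add_one_lt_of_arcIcc_ne_univ h
  unfold InSharp
  rw [ncard_arcIcc]
  change (_ - _ : ZMod (2 * n * n)).val ≤ (_ - _ : ZMod (2 * n * n)).val ↔ _
  rw [val_gapPoint_sub _ _ hk (by omega), val_gapPoint_sub _ _ (by omega) (by omega)]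
  have hg : g ∈ arcIcc n a b ↔ (g - a).val ≤ (b - a).val := Iff.rfl
  have hg' : g + 1 ∈ arcIcc n a b ↔ (g + 1 - a).val ≤ (b - a).val := Iff.rfl
  have h3 := ZMod.val_add_one_ite hn (g - a)
  have h4 := ZMod.val_add_one_ite hn (b - a)
  rw [hg, hg', show g + 1 - a = g - a + 1 by ring, show g - (a - 1) = g - a + 1 by ring,
    show b - (a - 1) = b - a + 1 by ring]
  rw [if_neg (by omega)] at h4
  have h5 := (g - a).val_lt
  rw [h4]
  generalize (g - a + 1).val = d at *
  generalize (g - a).val = z at *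
  generalize (b - a).val = L at *
  have e0 : 2 * n * (L + 1 + 1) ≤ 2 * n * n := Nat.mul_le_mul_left _ (by omega)
  have e1 : 2 * n * (L + 1 + 1) = 2 * n * (L + 1) + 2 * n := by ring
  have e2 : 2 * n * (L + 1) = 2 * n * L + 2 * n := by ring
  rw [if_neg (by omega : ¬ (L + 1 = 0 ∧ _))]
  rcases Nat.eq_zero_or_pos d with hd | hd
  · subst hd
    have hz : z = n - 1 := by split_ifs at h3; omega
    rw [mul_zero]
    split_ifs <;> omega
  · have hz : d = z + 1 := by split_ifs at h3 with hh <;> omega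
    subst hz
    rw [if_neg (by omega)]
    have e3 : 2 * n * (z + 1) = 2 * n * z + 2 * n := by ring
    rcases lt_trichotomy z L with hzL | hzL | hzL
    · have : 2 * n * (z + 1) ≤ 2 * n * L := Nat.mul_le_mul_left _ hzL
      omega
    · subst hzL
      omega
    · have : 2 * n * (L + 1) ≤ 2 * n * z := Nat.mul_le_mul_left _ hzL
      omega

theorem mem_arcIcc_iff_val {n : ℕ} [NeZero n] (a b x : ZMod n) :
    x ∈ arcIcc n a b ↔ (a.val ≤ x.val ∧ x.val ≤ b.val) ∨
      (b.val < a.val ∧ (a.val ≤ x.val ∨ x.val ≤ b.val)) := by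
  have key : ∀ y : ZMod n, (y - a).val = if a.val ≤ y.val then y.val - a.val
      else n + y.val - a.val := by
    intro y
    have h1 := a.val_lt
    have h2 := y.val_lt
    split_ifs with h
    · exact ZMod.val_sub h
    · have : y - a = ((n + y.val - a.val : ℕ) : ZMod n) := by
        rw [Nat.cast_sub (by omega)]
        simp
      rw [this, ZMod.val_natCast_of_lt (by omega)]
  change (x - a).val ≤ (b - a).val ↔ _
  have h1 := a.val_lt
  have h2 := x.val_lt
  have h3 := b.val_lt
  rw [key, key]
  split_ifs <;> omega

/-- The points of a nonempty subset of a circle can be relabelled as a circle of their own. -/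
theorem exists_relabelling {N m : ℕ} [NeZero N] [NeZero m] (E : Finset (ZMod N))
    (hE : E.card = m) :
    ∃ f : ZMod m → ZMod N, Function.Injective f ∧ Set.range f = E ∧
      ∀ a b x, x ∈ arcIcc m a b ↔ f x ∈ arcIcc N (f a) (f b) := by
  have hcard : (E.image ZMod.val).card = m := by
    rw [Finset.card_image_of_injective _ (ZMod.val_injective N), hE]
  let e := (E.image ZMod.val).orderEmbOfFin hcard
  let F : ZMod m → ℕ := fun x => e ⟨x.val, x.val_lt⟩
  have hF : ∀ x, F x ∈ E.image ZMod.val := fun x => Finset.orderEmbOfFin_mem _ _ _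
  have hle : ∀ x y, F x ≤ F y ↔ x.val ≤ y.val := fun x y => by simp [F]
  have hlt : ∀ x y, F x < F y ↔ x.val < y.val := fun x y => by simp [F]
  have hval : ∀ x, ((F x : ℕ) : ZMod N).val = F x := fun x => by
    obtain ⟨y, -, hy⟩ := Finset.mem_image.1 (hF x)
    rw [← hy, ZMod.natCast_zmod_val]
  refine ⟨fun x => (F x : ZMod N), ?_, ?_, ?_⟩
  · intro x y hxy
    have := congrArg ZMod.val hxy
    simp only [hval] at this
    exact ZMod.val_injective m (le_antisymm ((hle x y).1 this.le) ((hle y x).1 this.ge))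
  · ext y
    constructor
    · rintro ⟨x, rfl⟩
      obtain ⟨y, hyE, hy⟩ := Finset.mem_image.1 (hF x)
      simp only [← hy, ZMod.natCast_zmod_val]
      exact hyE
    · intro hy
      have : y.val ∈ Set.range e := by
        rw [Finset.range_orderEmbOfFin]
        exact_mod_cast Finset.mem_image_of_mem _ hy
      obtain ⟨i, hi⟩ := this
      refine ⟨((i : ℕ) : ZMod m), ?_⟩
      have hv : ((i : ℕ) : ZMod m).val = i := ZMod.val_natCast_of_lt i.2
      simp only [F, hv, Fin.eta, hi, ZMod.natCast_zmod_val]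
  · intro a b x
    rw [mem_arcIcc_iff_val, mem_arcIcc_iff_val]
    simp only [hval, hle, hlt]

theorem subset_of_common_end {n : ℕ} (hn : 2 ≤ n) {A B : Set (ZMod n)} (hA : IsArc n A)
    (hB : IsArc n B) {g : ZMod n} (hgA : g ∈ A) (hgA' : g + 1 ∉ A) (hgB : g ∈ B)
    (hgB' : g + 1 ∉ B) (hle : A.ncard ≤ B.ncard) : A ⊆ B := by
  have : NeZero n := ⟨by omega⟩
  obtain ⟨a, b, rfl⟩ := hA
  obtain ⟨c, d, rfl⟩ := hB
  obtain rfl := eq_of_mem_of_add_one_notMem_arcIcc hn hgA hgA'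
  obtain rfl := eq_of_mem_of_add_one_notMem_arcIcc hn hgB hgB'
  rw [ncard_arcIcc, ncard_arcIcc] at hle
  intro x hx
  rw [mem_arcIcc_iff_val_sub] at hx ⊢
  omega

theorem union_eq_univ_of_end_of_start {n : ℕ} (hn : 2 ≤ n) {A B : Set (ZMod n)}
    (hA : IsArc n A) (hB : IsArc n B) {g : ZMod n} (hgA : g ∈ A) (hgA' : g + 1 ∉ A)
    (hgB : g ∉ B) (hgB' : g + 1 ∈ B) (hAB : (A ∩ B).Nonempty) : A ∪ B = Set.univ := by
  have : NeZero n := ⟨by omega⟩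
  obtain ⟨a, b, rfl⟩ := hA
  obtain ⟨c, d, rfl⟩ := hB
  obtain rfl := eq_of_mem_of_add_one_notMem_arcIcc hn hgA hgA'
  obtain rfl := eq_of_notMem_of_add_one_mem_arcIcc hn hgB hgB'
  exact arcIcc_union_eq_univ hAB

theorem ncard_add_ncard_le_of_disjoint {n : ℕ} [NeZero n] {A B : Set (ZMod n)}
    (h : A ∩ B = ∅) : A.ncard + B.ncard ≤ n := by
  have h1 := Set.ncard_union_add_ncard_inter A B
  have h2 := Set.ncard_le_card (A ∪ B)
  rw [h, Set.ncard_empty] at h1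
  rw [Nat.card_zmod] at h2
  omega

theorem lt_ncard_add_ncard_of_cover {n : ℕ} [NeZero n] {A B : Set (ZMod n)}
    (h : (A ∩ B).Nonempty) (h' : A ∪ B = Set.univ) : n < A.ncard + B.ncard := by
  have h1 := Set.ncard_union_add_ncard_inter A B
  have h2 := h.ncard_pos
  rw [h', Set.ncard_univ, Nat.card_zmod] at h1
  omega

theorem ncard_lt_of_ne_univ {n : ℕ} [NeZero n] {A : Set (ZMod n)} (h : A ≠ Set.univ) :
    A.ncard < n := by
  simpa using Set.ncard_lt_card h

theorem InSharp.mono {n : ℕ} [NeZero n] {A B : Set (ZMod n)} (hAB : A ⊆ B) {g : ZMod n} {k : ℕ}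
    (h : InSharp A g k) : InSharp B g k := by
  have hc := Set.ncard_le_ncard hAB
  unfold InSharp at h ⊢
  rcases h with ⟨h1, h2⟩ | ⟨-, h2, h3⟩ | ⟨h1, -, h3⟩
  · exact Or.inl ⟨hAB h1, hAB h2⟩
  · by_cases h4 : g ∈ B
    · exact Or.inl ⟨h4, hAB h2⟩
    · exact Or.inr (Or.inl ⟨h4, hAB h2, by omega⟩)
  · by_cases h4 : g + 1 ∈ B
    · exact Or.inl ⟨hAB h1, h4⟩
    · exact Or.inr (Or.inr ⟨hAB h1, h4, by omega⟩)

theorem not_inSharp_of_disjoint {n : ℕ} [NeZero n] {A B : Set (ZMod n)} (h : A ∩ B = ∅)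
    {g : ZMod n} {k : ℕ} (hA : InSharp A g k) : ¬ InSharp B g k := by
  have hc := ncard_add_ncard_le_of_disjoint h
  have hd : ∀ x, x ∈ A → x ∉ B := fun x hx hx' => by
    have : x ∈ A ∩ B := ⟨hx, hx'⟩
    simp [h] at this
  have h0 := hd g
  have h1 := hd (g + 1)
  unfold InSharp at hA ⊢
  rintro (hB | hB | hB) <;> rcases hA with hA | hA | hA <;> first | tauto | omega

theorem InSharp.or_of_cover {n : ℕ} [NeZero n] {A B : Set (ZMod n)} (h : (A ∩ B).Nonempty)
    (h' : A ∪ B = Set.univ) (g : ZMod n) (k : ℕ) : InSharp A g k ∨ InSharp B g k := by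
  have hc := lt_ncard_add_ncard_of_cover h h'
  have hd : ∀ x, x ∈ A ∨ x ∈ B := fun x => by
    have : x ∈ A ∪ B := h' ▸ Set.mem_univ x
    exact this
  have h0 := hd g
  have h1 := hd (g + 1)
  have h2 : k ≤ 2 * A.ncard ∨ 2 * (n - B.ncard) + 1 ≤ k := by omega
  have h3 : k ≤ 2 * B.ncard ∨ 2 * (n - A.ncard) + 1 ≤ k := by omega
  unfold InSharp
  tauto

/-- In a circle cover, the sharpening of each arc contains the start of the other one. -/
theorem InSharp.start_of_cover {n : ℕ} [NeZero n] {A B : Set (ZMod n)}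
    (h : (A ∩ B).Nonempty) (h' : A ∪ B = Set.univ) {g : ZMod n} (hg : g ∉ B) :
    InSharp A g (2 * (n - B.ncard) + 1) := by
  have hc := lt_ncard_add_ncard_of_cover h h'
  have hgA : g ∈ A := (h' ▸ Set.mem_univ g : g ∈ A ∪ B).resolve_right hg
  have : 2 * (n - B.ncard) + 1 ≤ 2 * A.ncard := by
    have := h.mono Set.inter_subset_left |>.ncard_pos
    omega
  unfold InSharp
  tauto

/-- In a circle cover, the sharpening of each arc contains the end of the other one. -/
theorem InSharp.end_of_cover {n : ℕ} [NeZero n] {A B : Set (ZMod n)}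
    (h : (A ∩ B).Nonempty) (h' : A ∪ B = Set.univ) {g : ZMod n} (hg : g + 1 ∉ B) :
    InSharp A g (2 * B.ncard) := by
  have hc := lt_ncard_add_ncard_of_cover h h'
  have hgA : g + 1 ∈ A := (h' ▸ Set.mem_univ (g + 1) : g + 1 ∈ A ∪ B).resolve_right hg
  have : 2 * (n - A.ncard) + 1 ≤ 2 * B.ncard := by
    have := h.mono Set.inter_subset_right |>.ncard_pos
    omega
  unfold InSharp
  tauto

/-- Proper arcs get designated extreme points on a circle of twice their number of points, so
that membership in the resulting sharp arcs is described by `InSharp`. -/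
theorem exists_sharp_relabelling {n : ℕ} (hn : 2 ≤ n) (𝒜 : Set (Set (ZMod n)))
    (hne : 𝒜.Nonempty) (hArc : ∀ A ∈ 𝒜, IsArc n A) (hun : ∀ A ∈ 𝒜, A ≠ Set.univ) :
    ∃ (σ : Set (ZMod n) → ZMod (2 * 𝒜.ncard) × ZMod (2 * 𝒜.ncard)),
      Set.InjOn σ 𝒜 ∧ SharpSys (σ '' 𝒜) ∧
      (∀ y, ∃ g k, ∀ B ∈ 𝒜, y ∈ arcPts (σ B) ↔ InSharp B g k) ∧
      (∀ A ∈ 𝒜, ∃ a, a ∉ A ∧ a + 1 ∈ A ∧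
        ∀ B ∈ 𝒜, (σ A).1 ∈ arcPts (σ B) ↔ InSharp B a (2 * (n - A.ncard) + 1)) ∧
      (∀ A ∈ 𝒜, ∀ b ∈ A, b + 1 ∉ A →
        ∀ B ∈ 𝒜, (σ A).2 ∈ arcPts (σ B) ↔ InSharp B b (2 * A.ncard)) := by
  classical
  have : NeZero n := ⟨by omega⟩
  have hfin : 𝒜.Finite := Set.toFinite _
  have : NeZero (2 * 𝒜.ncard) := ⟨by have := hne.ncard_pos; omega⟩
  choose! st en hse using hArc
  have hun' : ∀ A ∈ 𝒜, arcIcc n (st A) (en A) ≠ Set.univ := fun A hA => hse A hA ▸ hun A hA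
  have hlt : ∀ A ∈ 𝒜, A.ncard < n := fun A hA => ncard_lt_of_ne_univ (hun A hA)
  have hpos : ∀ A ∈ 𝒜, 0 < A.ncard := fun A hA => by
    rw [hse A hA, ncard_arcIcc]; omega
  let S : Set (ZMod n) → ZMod (2 * n * n) := fun A =>
    gapPoint n (st A - 1) (2 * (n - A.ncard) + 1)
  let T : Set (ZMod n) → ZMod (2 * n * n) := fun A => gapPoint n (en A) (2 * A.ncard)
  have hval : ∀ A ∈ 𝒜, A.ncard = (en A - st A).val + 1 := fun A hA => by
    conv_lhs => rw [hse A hA, ncard_arcIcc]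
  have hSinj : Set.InjOn S 𝒜 := by
    intro A hA B hB hAB
    have h1 := hlt A hA
    have h2 := hlt B hB
    have h3 := hpos A hA
    have h4 := hpos B hB
    obtain ⟨h5, h6⟩ := gapPoint_inj (by omega) (by omega) hAB
    have h5 := sub_left_injective h5
    rw [hval A hA, hval B hB] at *
    have h7 : (en A - st A).val = (en B - st B).val := by omega
    have h7 := ZMod.val_injective n h7
    rw [h5] at h7
    rw [hse A hA, hse B hB, h5, sub_left_injective h7]
  have hTinj : Set.InjOn T 𝒜 := by
    intro A hA B hB hAB
    have h1 := hlt A hA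
    have h2 := hlt B hB
    obtain ⟨h5, h6⟩ := gapPoint_inj (by omega) (by omega) hAB
    rw [hval A hA, hval B hB] at *
    have h7 : (en A - st A).val = (en B - st B).val := by omega
    have h7 := ZMod.val_injective n h7
    rw [h5] at h7
    rw [hse A hA, hse B hB, h5, sub_right_injective h7]
  have hST : ∀ A ∈ 𝒜, ∀ B ∈ 𝒜, S A ≠ T B := by
    intro A hA B hB hAB
    have h1 := hlt A hA
    have h2 := hlt B hB
    have h3 := hpos A hA
    obtain ⟨h5, h6⟩ := gapPoint_inj (by omega) (by omega) hAB
    omega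
  let E : Finset (ZMod (2 * n * n)) := hfin.toFinset.image S ∪ hfin.toFinset.image T
  have hE : E.card = 2 * 𝒜.ncard := by
    rw [Finset.card_union_of_disjoint, Finset.card_image_of_injOn, Finset.card_image_of_injOn,
      Set.ncard_eq_toFinset_card 𝒜 hfin, two_mul]
    · simpa using hTinj
    · simpa using hSinj
    · rw [Finset.disjoint_left]
      intro x hx hx'
      simp only [Finset.mem_image, Set.Finite.mem_toFinset] at hx hx'
      obtain ⟨A, hA, rfl⟩ := hx
      obtain ⟨B, hB, h⟩ := hx'
      exact hST A hA B hB h.symm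
  obtain ⟨f, hf, hfE, hfarc⟩ := exists_relabelling E hE
  have hmemE : ∀ x, x ∈ E ↔ ∃ A ∈ 𝒜, S A = x ∨ T A = x := by
    intro x
    simp only [E, Finset.mem_union, Finset.mem_image, Set.Finite.mem_toFinset]
    constructor
    · rintro (⟨A, hA, h⟩ | ⟨A, hA, h⟩)
      exacts [⟨A, hA, Or.inl h⟩, ⟨A, hA, Or.inr h⟩]
    · rintro ⟨A, hA, h | h⟩
      exacts [Or.inl ⟨A, hA, h⟩, Or.inr ⟨A, hA, h⟩]
  have hfy : ∀ y, ∃ A ∈ 𝒜, S A = f y ∨ T A = f y := fun y => by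
    rw [← hmemE]
    have : f y ∈ (E : Set _) := hfE ▸ Set.mem_range_self y
    exact this
  have hex : ∀ A ∈ 𝒜, ∃ p : ZMod (2 * 𝒜.ncard) × ZMod (2 * 𝒜.ncard),
      f p.1 = S A ∧ f p.2 = T A := by
    intro A hA
    have h1 : S A ∈ Set.range f := by
      rw [hfE]; exact (hmemE _).2 ⟨A, hA, Or.inl rfl⟩
    have h2 : T A ∈ Set.range f := by
      rw [hfE]; exact (hmemE _).2 ⟨A, hA, Or.inr rfl⟩
    obtain ⟨p, hp⟩ := h1
    obtain ⟨q, hq⟩ := h2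
    exact ⟨(p, q), hp, hq⟩
  choose! σ hσS hσT using hex
  have hmem : ∀ y g k, k < 2 * n → f y = gapPoint n g k → ∀ B ∈ 𝒜,
      (y ∈ arcPts (σ B) ↔ InSharp B g k) := by
    intro y g k hk hy B hB
    have := gapPoint_mem_arcIcc_iff hn (hun' B hB) g hk
    rw [← hse B hB] at this
    rw [arcPts, hfarc, hσS B hB, hσT B hB, hy]
    exact this
  have hσinj : Set.InjOn σ 𝒜 := fun A hA B hB h => hSinj hA hB (by
    rw [← hσS A hA, ← hσS B hB, h])
  refine ⟨σ, hσinj, ⟨?_, ?_⟩, ?_, ?_, ?_⟩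
  · rw [Nat.card_coe_set_eq, hσinj.ncard_image]
  · intro x
    obtain ⟨A, hA, hAx⟩ := hfy x
    refine ⟨σ A, ⟨⟨A, hA, rfl⟩, ?_⟩, ?_⟩
    · rw [← hf.eq_iff, ← hf.eq_iff, hσS A hA, hσT A hA]
      exact hAx
    · rintro _ ⟨⟨B, hB, rfl⟩, hBx⟩
      rw [← hf.eq_iff, ← hf.eq_iff, hσS B hB, hσT B hB] at hBx
      congr 1
      rcases hAx with h | h <;> rcases hBx with h' | h'
      · exact hSinj hB hA (h'.trans h.symm)
      · exact absurd (h.trans h'.symm) (hST A hA B hB)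
      · exact absurd (h'.trans h.symm) (hST B hB A hA)
      · exact hTinj hB hA (h'.trans h.symm)
  · intro y
    obtain ⟨A, hA, hy⟩ := hfy y
    have h1 := hlt A hA
    have h2 := hpos A hA
    rcases hy with hy | hy
    · exact ⟨_, _, hmem y _ _ (by omega) hy.symm⟩
    · exact ⟨_, _, hmem y _ _ (by omega) hy.symm⟩
  · intro A hA
    have h1 := hlt A hA
    have h2 := hpos A hA
    refine ⟨st A - 1, ?_, ?_, hmem _ _ _ (by omega) (hσS A hA)⟩
    · rw [hse A hA]
      convert left_sub_one_notMem_arcIcc hn (hun' A hA) using 2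
      rw [← hse A hA]
    · rw [sub_add_cancel]
      have := left_mem_arcIcc (st A) (en A)
      rwa [← hse A hA] at this
  · intro A hA b hb hb'
    have h1 := hlt A hA
    refine hmem _ _ _ (by omega) ?_
    rw [hse A hA] at hb hb'
    rw [hσT A hA, eq_of_mem_of_add_one_notMem_arcIcc hn hb hb']

theorem exists_sharpening {n : ℕ} (hn : 2 ≤ n) (𝒜 : Set (Set (ZMod n)))
    (hArc : ∀ A ∈ 𝒜, IsArc n A) (hun : ∀ A ∈ 𝒜, A ≠ Set.univ)
    (hsep : ∀ x y, x ≠ y → ∃ A ∈ 𝒜, x ∈ A ∧ y ∉ A)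
    (hmax : ∀ B ∈ 𝒜, ∀ x ∉ B, ∃ A ∈ 𝒜, x ∈ A ∧ A ∩ B = ∅) (hHelly : HellyFamily 𝒜) :
    ∃ m : ℕ, 3 ≤ m ∧
      ∃ (𝒜' : Set (ZMod m × ZMod m)) (σ : Set (ZMod n) → ZMod m × ZMod m),
        Set.BijOn σ 𝒜 𝒜' ∧ SharpSys 𝒜' ∧
        (∀ A ∈ 𝒜, ∀ B ∈ 𝒜,
          (A ∩ B = ∅ ↔ arcPts (σ A) ∩ arcPts (σ B) = ∅) ∧
          (A ⊆ B ↔ arcPts (σ A) ⊆ arcPts (σ B)) ∧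
          (LeftOv A B ↔ pLeftOv (σ A) (σ B)) ∧
          ((A ∩ B).Nonempty → (A ∪ B = Set.univ ↔ CircleCover (σ A) (σ B)))) ∧
        HellyFamily {S | ∃ p ∈ 𝒜', S = arcPts p} := by
  have : NeZero n := ⟨by omega⟩
  have : Fact (1 < n) := ⟨by omega⟩
  obtain ⟨A₀, hA₀, h₀, h₀'⟩ := hsep 0 1 zero_ne_one
  obtain ⟨A₁, hA₁, h₁, h₁'⟩ := hsep 1 0 one_ne_zero
  have hcard : 1 < 𝒜.ncard :=
    (Set.one_lt_ncard (Set.toFinite _)).2 ⟨A₀, hA₀, A₁, hA₁, fun h => h₁' (h ▸ h₀)⟩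
  obtain ⟨σ, hσ, hsharp, hpt, hstart, hend⟩ := exists_sharp_relabelling hn 𝒜 ⟨A₀, hA₀⟩ hArc hun
  have hstab : ∀ x, ∃ y, ∀ C ∈ 𝒜, x ∈ C → y ∈ arcPts (σ C) := by
    intro x
    let 𝓔 : Set (Set (ZMod n)) := {A | A ∈ 𝒜 ∧ x ∈ A ∧ x + 1 ∉ A}
    have h𝓔 : 𝓔.Nonempty := by
      obtain ⟨A, hA, h⟩ := hsep x (x + 1) (by simp)
      exact ⟨A, hA, h⟩
    obtain ⟨A, ⟨hA, hx, hx'⟩, hmin⟩ :=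
      Set.exists_min_image 𝓔 Set.ncard (Set.toFinite _) h𝓔
    refine ⟨(σ A).2, fun C hC hxC => ?_⟩
    rw [hend A hA x hx hx' C hC]
    by_cases hxC' : x + 1 ∈ C
    · exact Or.inl ⟨hxC, hxC'⟩
    · exact Or.inr (Or.inr ⟨hxC, hxC', Nat.mul_le_mul_left 2 (hmin C ⟨hC, hxC, hxC'⟩)⟩)
  have hdisj : ∀ A ∈ 𝒜, ∀ B ∈ 𝒜, A ∩ B = ∅ ↔ arcPts (σ A) ∩ arcPts (σ B) = ∅ := by
    intro A hA B hB
    constructor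
    · intro h
      refine Set.eq_empty_of_forall_notMem ?_
      rintro y ⟨hyA, hyB⟩
      obtain ⟨g, k, hgk⟩ := hpt y
      exact not_inSharp_of_disjoint h ((hgk A hA).1 hyA) ((hgk B hB).1 hyB)
    · intro h
      refine Set.eq_empty_of_forall_notMem ?_
      rintro x ⟨hxA, hxB⟩
      obtain ⟨y, hy⟩ := hstab x
      exact Set.eq_empty_iff_forall_notMem.1 h y ⟨hy A hA hxA, hy B hB hxB⟩
  have hsub : ∀ A ∈ 𝒜, ∀ B ∈ 𝒜, A ⊆ B ↔ arcPts (σ A) ⊆ arcPts (σ B) := by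
    intro A hA B hB
    constructor
    · intro h y hy
      obtain ⟨g, k, hgk⟩ := hpt y
      rw [hgk B hB]
      exact InSharp.mono h ((hgk A hA).1 hy)
    · intro h x hx
      by_contra hxB
      obtain ⟨T, hT, hxT, hTB⟩ := hmax B hB x hxB
      obtain ⟨y, hy⟩ := hstab x
      exact Set.eq_empty_iff_forall_notMem.1 ((hdisj T hT B hB).1 hTB) y
        ⟨hy T hT hxT, h (hy A hA hx)⟩
  have hcov : ∀ A ∈ 𝒜, ∀ B ∈ 𝒜, (A ∩ B).Nonempty → A ∪ B = Set.univ →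
      CircleCover (σ A) (σ B) := by
    intro A hA B hB h h'
    have hBA : (B ∩ A).Nonempty := Set.inter_comm A B ▸ h
    have hBA' : B ∪ A = Set.univ := Set.union_comm A B ▸ h'
    have hend' : ∀ C ∈ 𝒜, ∃ b ∈ C, b + 1 ∉ C := by
      intro C hC
      have hC' := hun C hC
      obtain ⟨c, d, rfl⟩ := hArc C hC
      exact ⟨d, right_mem_arcIcc c d, right_add_one_notMem_arcIcc hn hC'⟩
    obtain ⟨a, ha, -, hsA⟩ := hstart A hA
    obtain ⟨b, hb, -, hsB⟩ := hstart B hB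
    obtain ⟨a', ha', ha''⟩ := hend' A hA
    obtain ⟨b', hb', hb''⟩ := hend' B hB
    refine ⟨Set.eq_univ_of_forall fun y => ?_, ?_, ?_, ?_, ?_⟩
    · obtain ⟨g, k, hgk⟩ := hpt y
      rw [Set.mem_union, hgk A hA, hgk B hB]
      exact InSharp.or_of_cover h h' g k
    · exact (hsB A hA).2 (InSharp.start_of_cover h h' hb)
    · exact (hend B hB b' hb' hb'' A hA).2 (InSharp.end_of_cover h h' hb'')
    · exact (hsA B hB).2 (InSharp.start_of_cover hBA hBA' ha)
    · exact (hend A hA a' ha' ha'' B hB).2 (InSharp.end_of_cover hBA hBA' ha'')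
  have hcov' : ∀ A ∈ 𝒜, ∀ B ∈ 𝒜, arcPts (σ A) ∪ arcPts (σ B) = Set.univ →
      A ∪ B = Set.univ := by
    intro A hA B hB h
    refine Set.eq_univ_of_forall fun x => ?_
    by_contra hx
    rw [Set.mem_union, not_or] at hx
    obtain ⟨T, hT, hxT, hTA⟩ := hmax A hA x hx.1
    refine hx.2 ((hsub T hT B hB).2 (fun y hy => ?_) hxT)
    refine (h ▸ Set.mem_univ y : y ∈ arcPts (σ A) ∪ arcPts (σ B)).resolve_left fun hy' => ?_
    exact Set.eq_empty_iff_forall_notMem.1 ((hdisj T hT A hA).1 hTA) y ⟨hy, hy'⟩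
  have hov : ∀ A ∈ 𝒜, ∀ B ∈ 𝒜,
      StrictOv A B ↔ StrictOv (arcPts (σ A)) (arcPts (σ B)) := by
    intro A hA B hB
    unfold StrictOv SetsOverlap
    rw [← hsub A hA B hB, ← hsub B hB A hA, Set.nonempty_iff_ne_empty, Set.nonempty_iff_ne_empty,
      Ne, Ne, hdisj A hA B hB]
    refine and_congr_right fun h => not_congr ⟨fun h' => ?_, hcov' A hA B hB⟩
    refine (hcov A hA B hB ?_ h').1
    rw [Set.nonempty_iff_ne_empty, Ne, hdisj A hA B hB]
    exact h.1
  refine ⟨2 * 𝒜.ncard, by omega, σ '' 𝒜, σ, hσ.bijOn_image, hsharp, ?_, ?_⟩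
  · intro A hA B hB
    refine ⟨hdisj A hA B hB, hsub A hA B hB, ?_,
      fun h => ⟨hcov A hA B hB h, fun h' => hcov' A hA B hB h'.1⟩⟩
    unfold LeftOv pLeftOv
    rw [← hov A hA B hB]
    refine and_congr_right fun hAB => ?_
    constructor
    · rintro ⟨a, b, hAab, hAun, hbB⟩
      have hb : b ∈ A := hAab ▸ right_mem_arcIcc a b
      have hb' : b + 1 ∉ A := by
        have := right_add_one_notMem_arcIcc hn (hAab ▸ hAun)
        rwa [← hAab] at this
      rw [hend A hA b hb hb' B hB]
      by_cases hbB' : b + 1 ∈ B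
      · exact Or.inl ⟨hbB, hbB'⟩
      · exfalso
        rcases le_total A.ncard B.ncard with h | h
        · exact hAB.1.2.1
            (subset_of_common_end hn (hArc A hA) (hArc B hB) hb hb' hbB hbB' h)
        · exact hAB.1.2.2
            (subset_of_common_end hn (hArc B hB) (hArc A hA) hbB hbB' hb hb' h)
    · intro h
      obtain ⟨a, b, hAab⟩ := hArc A hA
      have hb : b ∈ A := hAab ▸ right_mem_arcIcc a b
      have hb' : b + 1 ∉ A := by
        have := right_add_one_notMem_arcIcc hn (hAab ▸ hun A hA)
        rwa [← hAab] at this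
      rw [hend A hA b hb hb' B hB] at h
      refine ⟨a, b, hAab, hun A hA, ?_⟩
      by_contra hbB
      have hbB' : b + 1 ∈ B := by
        unfold InSharp at h
        tauto
      exact hAB.2 (union_eq_univ_of_end_of_start hn (hArc A hA) (hArc B hB) hb hb' hbB hbB'
        hAB.1.1)
  · intro S hS hSne hpair
    let 𝒮 : Set (Set (ZMod n)) := {A | A ∈ 𝒜 ∧ arcPts (σ A) ∈ S}
    have hS𝒮 : ∀ s ∈ S, ∃ A ∈ 𝒮, s = arcPts (σ A) := by
      intro s hs
      obtain ⟨_, ⟨A, hA, rfl⟩, rfl⟩ := hS hs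
      exact ⟨A, ⟨hA, hs⟩, rfl⟩
    obtain ⟨s, hs⟩ := hSne
    obtain ⟨A, hA, -⟩ := hS𝒮 s hs
    obtain ⟨x, hx⟩ := hHelly 𝒮 (fun A hA => hA.1) ⟨A, hA⟩ (fun A hA B hB => by
      have := hpair _ hA.2 _ hB.2
      rwa [Set.nonempty_iff_ne_empty, Ne, hdisj A hA.1 B hB.1, ← Ne,
        ← Set.nonempty_iff_ne_empty])
    obtain ⟨y, hy⟩ := hstab x
    refine ⟨y, fun s hs => ?_⟩
    obtain ⟨A, hA, rfl⟩ := hS𝒮 s hs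
    exact hy A hA.1 (hx A hA)

theorem SimpleGraph.IsClique.exists_isMaxclique_superset {V : Type*} [Finite V]
    {G : SimpleGraph V} {C : Set V} (hC : G.IsClique C) : ∃ D, G.IsMaxclique D ∧ C ⊆ D := by
  obtain ⟨D, hCD, hD⟩ := (Set.toFinite {D : Set V | G.IsClique D}).exists_le_maximal hC
  exact ⟨D, ⟨hD.prop, fun D' hD' h => (hD.eq_of_le hD' h).symm⟩, hCD⟩

theorem SimpleGraph.bundle_inter_nonempty_iff {V : Type*} [Finite V]
    (G : SimpleGraph V) {u v : V} :
    (G.bundle u ∩ G.bundle v).Nonempty ↔ u = v ∨ G.Adj u v := by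
  constructor
  · rintro ⟨C, ⟨hC, hu⟩, -, hv⟩
    by_cases h : u = v
    · exact Or.inl h
    · exact Or.inr (hC.1 hu hv h)
  · intro h
    have : G.IsClique {u, v} := by
      rw [SimpleGraph.isClique_pair]
      exact fun hne => h.resolve_left hne
    obtain ⟨D, hD, huv⟩ := this.exists_isMaxclique_superset
    exact ⟨D, ⟨hD, huv (by simp)⟩, hD, huv (by simp)⟩

/-- Let `G` be a finite HCA graph with no twins and no universal vertices, and let
`𝒜` (an arc system, isomorphic to `B(G)` via `ρ`) be an arc model of the bundle
hypergraph `B(G)`.  Then `𝒜` can be sharpened: there is a bijection `σ` from `𝒜`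
onto a sharp arc system `𝒜'` satisfying conditions (1)–(4) of a sharpening, such
that `𝒜'` has the Helly property. -/
theorem stmt8 {V : Type*} [Fintype V] (G : SimpleGraph V)
    (hHCA : IsHCA G)
    (hTwins : ∀ u v : V, G.closedNbhd u = G.closedNbhd v → u = v)
    (hUniv : ∀ u : V, G.closedNbhd u ≠ Set.univ)
    (n : ℕ) (hn : 3 ≤ n) (𝒜 : Set (Set (ZMod n))) (hArc : ∀ A ∈ 𝒜, IsArc n A)
    (ρ : Set V → ZMod n)
    (hbij : Set.BijOn ρ {C | G.IsMaxclique C} Set.univ)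
    (hiso : ∀ S : Set (Set V), S ⊆ {C | G.IsMaxclique C} →
      ((∃ v : V, S = G.bundle v) ↔ ρ '' S ∈ 𝒜)) :
    ∃ m : ℕ, 3 ≤ m ∧
      ∃ (𝒜' : Set (ZMod m × ZMod m)) (σ : Set (ZMod n) → ZMod m × ZMod m),
        Set.BijOn σ 𝒜 𝒜' ∧ SharpSys 𝒜' ∧
        (∀ A ∈ 𝒜, ∀ B ∈ 𝒜,
          (A ∩ B = ∅ ↔ arcPts (σ A) ∩ arcPts (σ B) = ∅) ∧
          (A ⊆ B ↔ arcPts (σ A) ⊆ arcPts (σ B)) ∧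
          (LeftOv A B ↔ pLeftOv (σ A) (σ B)) ∧
          ((A ∩ B).Nonempty → (A ∪ B = Set.univ ↔ CircleCover (σ A) (σ B)))) ∧
        HellyFamily {S | ∃ p ∈ 𝒜', S = arcPts p} := by
  have hbdl : ∀ v, G.bundle v ⊆ {C | G.IsMaxclique C} := fun v C hC => hC.1
  have hmem : ∀ v, ρ '' G.bundle v ∈ 𝒜 := fun v => (hiso _ (hbdl v)).1 ⟨v, rfl⟩
  have h𝒜 : ∀ A ∈ 𝒜, ∃ v, A = ρ '' G.bundle v := by
    intro A hA
    have himg : ρ '' ({C | G.IsMaxclique C} ∩ ρ ⁻¹' A) = A := by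
      rw [Set.image_inter_preimage, hbij.image_eq, Set.univ_inter]
    obtain ⟨v, hv⟩ := (hiso _ Set.inter_subset_left).2 (himg.symm ▸ hA)
    exact ⟨v, by rw [← hv, himg]⟩
  have hρ : ∀ {C v}, G.IsMaxclique C → (ρ C ∈ ρ '' G.bundle v ↔ v ∈ C) := by
    intro C v hC
    rw [hbij.injOn.mem_image_iff (hbdl v) hC]
    exact ⟨fun h => h.2, fun h => ⟨hC, h⟩⟩
  have hinter : ∀ u v, (ρ '' G.bundle u ∩ ρ '' G.bundle v).Nonempty ↔ u = v ∨ G.Adj u v := by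
    intro u v
    rw [← hbij.injOn.image_inter (hbdl u) (hbdl v), Set.image_nonempty,
      G.bundle_inter_nonempty_iff]
  refine exists_sharpening (by omega) 𝒜 hArc ?_ ?_ ?_ ?_
  · intro A hA hAun
    obtain ⟨v, rfl⟩ := h𝒜 A hA
    refine hUniv v (Set.eq_univ_of_forall fun u => (hinter u v).1 ?_)
    rw [hAun, Set.inter_univ, Set.image_nonempty]
    obtain ⟨C, hC, -⟩ := (G.bundle_inter_nonempty_iff (u := u)).2 (Or.inl rfl)
    exact ⟨C, hC⟩
  · intro x y hxy
    obtain ⟨C, hC, rfl⟩ := hbij.surjOn (Set.mem_univ x)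
    obtain ⟨D, hD, rfl⟩ := hbij.surjOn (Set.mem_univ y)
    have : ¬ C ⊆ D := fun h => hxy (by rw [hC.2 D hD.1 h])
    obtain ⟨v, hvC, hvD⟩ := Set.not_subset.1 this
    exact ⟨_, hmem v, (hρ hC).2 hvC, fun h => hvD ((hρ hD).1 h)⟩
  · intro B hB x hx
    obtain ⟨w, rfl⟩ := h𝒜 B hB
    obtain ⟨C, hC, rfl⟩ := hbij.surjOn (Set.mem_univ x)
    rw [hρ hC] at hx
    by_contra! hcon
    have hcl : G.IsClique (insert w C) := by
      refine hC.1.insert fun v hv hwv => ?_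
      have := hcon _ (hmem v) ((hρ hC).2 hv)
      exact (((hinter v w).1 this).resolve_left hwv.symm).symm
    exact hx (hC.2 _ hcl (Set.subset_insert w C) ▸ Set.mem_insert w C)
  · intro S hS _ hpair
    have hcl : G.IsClique {v | ρ '' G.bundle v ∈ S} := fun u hu v hv huv =>
      ((hinter u v).1 (hpair _ hu _ hv)).resolve_left huv
    obtain ⟨D, hD, hsub⟩ := hcl.exists_isMaxclique_superset
    refine ⟨ρ D, fun A hA => ?_⟩
    obtain ⟨v, rfl⟩ := h𝒜 A (hS hA)
    exact (hρ hD).2 (hsub hA)
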